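/- arXiv:2112.06870 — 2 statements merged into one kernel-verified Lean document; each statement's English description precedes it below -/
import Mathlib

section
/- Let d ≥ 2 and let E := Σ_{i=1}^{d-1} i·E_{i,i+1}, F := Σ_{i=1}^{d-1} (d−i)·E_{i+1,i}, H := Σ_{i=1}^{d} (d+1−2i)·E_{i,i} be d×d complex matrices. Then for every integer n with 0 ≤ n ≤ d−2 such that d−2−n is even, the trace Tr(E^n · F^n · H^{d−2−n}) is nonzero (indeed it is a positive integer). -/
open Matrix

/-- `E = ∑_{i=1}^{d-1} i · E_{i,i+1}` (1-based indices), written entrywise with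
0-based indices: the `(a, a+1)` entry is `a+1`. -/
noncomputable def matE (d : ℕ) : Matrix (Fin d) (Fin d) ℂ :=
  Matrix.of fun a b => if (b : ℕ) = (a : ℕ) + 1 then (((a : ℕ) + 1 : ℕ) : ℂ) else 0

/-- `F = ∑_{i=1}^{d-1} (d-i) · E_{i+1,i}`: the `(b+1, b)` entry is `d - (b+1)`. -/
noncomputable def matF (d : ℕ) : Matrix (Fin d) (Fin d) ℂ :=
  Matrix.of fun a b => if (a : ℕ) = (b : ℕ) + 1 then ((d : ℂ) - (((b : ℕ) + 1 : ℕ) : ℂ)) else 0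

/-- `H = ∑_{i=1}^{d} (d+1-2i) · E_{i,i}`: the `(a, a)` entry is `d + 1 - 2(a+1)`. -/
noncomputable def matH (d : ℕ) : Matrix (Fin d) (Fin d) ℂ :=
  Matrix.of fun a b => if a = b then ((d : ℂ) + 1 - 2 * (((a : ℕ) + 1 : ℕ) : ℂ)) else 0

/-- A product of matrices over `ℕ` has a positive entry as soon as one of the paths
contributing to it does. -/
theorem Matrix.mul_apply_pos_of_nat {ι : Type*} [Fintype ι] {A B : Matrix ι ι ℕ} {i j k : ι}
    (hA : 0 < A i j) (hB : 0 < B j k) : 0 < (A * B) i k := by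
  rw [Matrix.mul_apply]
  exact Finset.sum_pos' (fun _ _ => Nat.zero_le _) ⟨j, Finset.mem_univ j, Nat.mul_pos hA hB⟩

theorem Matrix.trace_pos_of_nat {ι : Type*} [Fintype ι] {A : Matrix ι ι ℕ} {i : ι}
    (hA : 0 < A i i) : 0 < A.trace :=
  Finset.sum_pos' (fun _ _ => Nat.zero_le _) ⟨i, Finset.mem_univ i, hA⟩

/-- The matrix `E` with natural number entries. -/
def natE (d : ℕ) : Matrix (Fin d) (Fin d) ℕ :=
  Matrix.of fun a b => if (b : ℕ) = (a : ℕ) + 1 then (a : ℕ) + 1 else 0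

/-- The matrix `F` with natural number entries. -/
def natF (d : ℕ) : Matrix (Fin d) (Fin d) ℕ :=
  Matrix.of fun a b => if (a : ℕ) = (b : ℕ) + 1 then d - ((b : ℕ) + 1) else 0

/-- The square of the matrix `H`, with natural number entries. -/
def natHSq (d : ℕ) : Matrix (Fin d) (Fin d) ℕ :=
  Matrix.diagonal fun a => ((d : ℤ) + 1 - 2 * ((a : ℕ) + 1 : ℕ)).natAbs ^ 2

theorem mapMatrix_natE (d : ℕ) : (Nat.castRingHom ℂ).mapMatrix (natE d) = matE d := by
  ext a b
  simp [natE, matE, apply_ite (Nat.cast : ℕ → ℂ)]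

theorem mapMatrix_natF (d : ℕ) : (Nat.castRingHom ℂ).mapMatrix (natF d) = matF d := by
  ext a b
  by_cases h : (a : ℕ) = b + 1
  · have hb : (b : ℕ) + 1 ≤ d := by omega
    simp [natF, matF, h, Nat.cast_sub hb]
  · simp [natF, matF, h]

theorem mapMatrix_natHSq (d : ℕ) :
    (Nat.castRingHom ℂ).mapMatrix (natHSq d) = matH d ^ 2 := by
  have hH : matH d = Matrix.diagonal fun a : Fin d =>
      (d : ℂ) + 1 - 2 * (((a : ℕ) + 1 : ℕ) : ℂ) := by
    ext a b
    simp [matH, Matrix.diagonal_apply]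
  have hcast (z : ℤ) : ((z.natAbs ^ 2 : ℕ) : ℂ) = (z : ℂ) ^ 2 := by
    rw [← Int.cast_natCast, Nat.cast_pow, Int.natAbs_sq, Int.cast_pow]
  rw [hH, Matrix.diagonal_pow, natHSq, RingHom.mapMatrix_apply,
    Matrix.diagonal_map (map_zero _)]
  congr 1
  ext a
  simp only [Pi.pow_apply, Nat.coe_castRingHom, hcast]
  push_cast
  rfl

theorem natE_pow_apply_pos {d : ℕ} (n : ℕ) (h : n < d) :
    0 < (natE d ^ n) ⟨0, by omega⟩ ⟨n, h⟩ := by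
  induction n with
  | zero => simp
  | succ n ih =>
    rw [pow_succ]
    exact Matrix.mul_apply_pos_of_nat (ih (by omega)) (by simp [natE])

theorem natF_pow_apply_pos {d : ℕ} (n : ℕ) (h : n < d) :
    0 < (natF d ^ n) ⟨n, h⟩ ⟨0, by omega⟩ := by
  induction n with
  | zero => simp
  | succ n ih =>
    rw [pow_succ']
    exact Matrix.mul_apply_pos_of_nat (j := ⟨n, by omega⟩) (by simp [natF]; omega)
      (ih (by omega))

theorem natHSq_pow_apply_pos {d : ℕ} (hd : 2 ≤ d) (k : ℕ) :
    0 < (natHSq d ^ k) ⟨0, by omega⟩ ⟨0, by omega⟩ := by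
  rw [natHSq, Matrix.diagonal_pow, Matrix.diagonal_apply_eq]
  refine pow_pos (pow_pos (Int.natAbs_pos.mpr ?_) 2) k
  push_cast
  omega

/-- For `d ≥ 2` and `0 ≤ n ≤ d-2` with `d-2-n` even, `Tr(Eⁿ·Fⁿ·H^{d-2-n})` is a
positive integer; in particular it is nonzero. -/
theorem stmt6 (d : ℕ) (hd : 2 ≤ d) (n : ℕ) (hn : n ≤ d - 2) (hpar : Even (d - 2 - n)) :
    Matrix.trace ((matE d) ^ n * (matF d) ^ n * (matH d) ^ (d - 2 - n)) ≠ 0 ∧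
    ∃ m : ℕ, 0 < m ∧
      Matrix.trace ((matE d) ^ n * (matF d) ^ n * (matH d) ^ (d - 2 - n)) = (m : ℂ) := by
  obtain ⟨k, hk⟩ := even_iff_exists_two_mul.mp hpar
  have hnd : n < d := by omega
  have hpos : 0 < (natE d ^ n * natF d ^ n * natHSq d ^ k).trace :=
    Matrix.trace_pos_of_nat <| Matrix.mul_apply_pos_of_nat
      (Matrix.mul_apply_pos_of_nat (natE_pow_apply_pos n hnd) (natF_pow_apply_pos n hnd))
      (natHSq_pow_apply_pos hd k)
  have htrace : Matrix.trace ((matE d) ^ n * (matF d) ^ n * (matH d) ^ (d - 2 - n)) =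
      ((natE d ^ n * natF d ^ n * natHSq d ^ k).trace : ℂ) := by
    rw [hk, pow_mul, ← mapMatrix_natE, ← mapMatrix_natF, ← mapMatrix_natHSq, ← map_pow,
      ← map_pow, ← map_pow, ← map_mul, ← map_mul]
    exact (AddMonoidHom.map_trace (Nat.castRingHom ℂ) _).symm
  rw [htrace]
  exact ⟨Nat.cast_ne_zero.mpr hpos.ne', _, hpos, rfl⟩
end

section
/- Let d ≥ 3 and let g be the ℂ-linear span of the d×d complex matrices E := Σ_{i=1}^{d-1} i·E_{i,i+1}, F := Σ_{i=1}^{d-1} (d−i)·E_{i+1,i}, H := Σ_{i=1}^{d} (d+1−2i)·E_{i,i}. Then the set of all products M₁·M₂·⋯·M_{d−1} with each M_k ∈ g spans the full matrix algebra of d×d complex matrices as a ℂ-vector space. -/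
open Matrix

/-- The matrix with entries `w 0, w 1, …` on the first superdiagonal. -/
def superdiag (d : ℕ) (w : ℕ → ℂ) : Matrix (Fin d) (Fin d) ℂ :=
  Matrix.of fun a b => if (b : ℕ) = (a : ℕ) + 1 then w a else 0

lemma superdiag_pow_apply (d : ℕ) (w : ℕ → ℂ) (k : ℕ) (a b : Fin d) :
    (superdiag d w ^ k) a b =
      if (b : ℕ) = (a : ℕ) + k then ∏ j ∈ Finset.range k, w (a + j) else 0 := by
  induction k generalizing b with
  | zero => simp [Matrix.one_apply, Fin.ext_iff, eq_comm]
  | succ k ih =>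
    rw [pow_succ, Matrix.mul_apply]
    simp only [ih]
    simp only [superdiag, Matrix.of_apply]
    split_ifs with h
    · rw [Finset.sum_eq_single (⟨a + k, by omega⟩ : Fin d)]
      · simp [h, Finset.prod_range_succ, add_assoc]
      · intro c _ hc
        rw [if_neg (fun h' => hc (Fin.ext h')), zero_mul]
      · simp
    · refine Finset.sum_eq_zero fun c _ => ?_
      split_ifs <;> first | omega | simp

lemma matE_eq_superdiag (d : ℕ) : matE d = superdiag d fun n => (n : ℂ) + 1 := by
  ext a b
  simp [matE, superdiag]

lemma matF_eq_transpose_superdiag (d : ℕ) :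
    matF d = (superdiag d fun n => (d : ℂ) - ((n : ℂ) + 1))ᵀ := by
  ext a b
  simp [matF, superdiag]

lemma matH_eq_diagonal (d : ℕ) :
    matH d = diagonal fun a : Fin d => (d : ℂ) + 1 - 2 * (((a : ℕ) : ℂ) + 1) := by
  ext a b
  simp [matH, Matrix.diagonal_apply]

lemma matE_mul_matF (d : ℕ) :
    matE d * matF d =
      diagonal fun a : Fin d => (((a : ℕ) : ℂ) + 1) * ((d : ℂ) - (((a : ℕ) : ℂ) + 1)) := by
  ext a b
  rw [Matrix.mul_apply]
  simp only [matE, matF, Matrix.of_apply, Matrix.diagonal_apply]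
  split_ifs with h
  · subst h
    by_cases ha : (a : ℕ) + 1 < d
    · rw [Finset.sum_eq_single (⟨a + 1, ha⟩ : Fin d)]
      · simp
      · intro c _ hc
        rw [if_neg (fun h' => hc (Fin.ext h')), zero_mul]
      · simp
    · have hd : (d : ℂ) = ((a : ℕ) : ℂ) + 1 := by
        exact_mod_cast (by omega : d = (a : ℕ) + 1)
      rw [← hd, sub_self, mul_zero]
      refine Finset.sum_eq_zero fun c _ => ?_
      rw [if_neg (by omega), zero_mul]
  · refine Finset.sum_eq_zero fun c _ => ?_
    split_ifs <;> first | omega | simp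

lemma matF_mul_matE (d : ℕ) :
    matF d * matE d = diagonal fun a : Fin d => ((a : ℕ) : ℂ) * ((d : ℂ) - ((a : ℕ) : ℂ)) := by
  ext a b
  rw [Matrix.mul_apply]
  simp only [matE, matF, Matrix.of_apply, Matrix.diagonal_apply]
  split_ifs with h
  · subst h
    rcases Nat.eq_zero_or_pos (a : ℕ) with ha | ha
    · rw [ha, Nat.cast_zero, zero_mul]
      refine Finset.sum_eq_zero fun c _ => ?_
      rw [if_neg (by omega), zero_mul]
    · obtain ⟨n, hn⟩ : ∃ n, (a : ℕ) = n + 1 := ⟨a - 1, by omega⟩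
      rw [Finset.sum_eq_single (⟨n, by omega⟩ : Fin d)]
      · simp [hn, mul_comm]
      · intro c _ hc
        rw [if_neg (fun h' => hc (Fin.ext (by simp only; omega))), zero_mul]
      · simp
  · refine Finset.sum_eq_zero fun c _ => ?_
    split_ifs <;> first | omega | simp

lemma matE_commutator_matF (d : ℕ) : matE d * matF d - matF d * matE d = matH d := by
  rw [matE_mul_matF, matF_mul_matE, matH_eq_diagonal, Matrix.diagonal_sub]
  congr 1
  ext a
  ring

lemma matH_commutator_matE (d : ℕ) :
    matH d * matE d - matE d * matH d = (2 : ℂ) • matE d := by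
  rw [matH_eq_diagonal]
  ext a b
  simp only [Matrix.sub_apply, Matrix.diagonal_mul, Matrix.mul_diagonal, Matrix.smul_apply,
    matE, Matrix.of_apply, smul_eq_mul]
  split_ifs with h
  · rw [h]; push_cast; ring
  · ring

lemma matF_commutator_matH (d : ℕ) :
    matF d * matH d - matH d * matF d = (2 : ℂ) • matF d := by
  rw [matH_eq_diagonal]
  ext a b
  simp only [Matrix.sub_apply, Matrix.diagonal_mul, Matrix.mul_diagonal, Matrix.smul_apply,
    matF, Matrix.of_apply, smul_eq_mul]
  split_ifs with h
  · rw [h]; push_cast; ring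
  · ring

/-- The Casimir element acts as a scalar. -/
lemma casimir_eq_smul_one (d : ℕ) :
    (2 : ℂ) • (matE d * matF d + matF d * matE d) + matH d * matH d =
      ((d : ℂ) ^ 2 - 1) • (1 : Matrix (Fin d) (Fin d) ℂ) := by
  rw [matE_mul_matF, matF_mul_matE, matH_eq_diagonal, Matrix.diagonal_mul_diagonal,
    Matrix.diagonal_add, ← Matrix.diagonal_smul, Matrix.diagonal_add, ← Matrix.diagonal_one,
    ← Matrix.diagonal_smul]
  congr 1
  ext a
  simp only [Pi.smul_apply, smul_eq_mul]
  ring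

/-- The image of `sl₂(ℂ)` in the `d`-dimensional irreducible representation. -/
noncomputable def sl2Image (d : ℕ) : Submodule ℂ (Matrix (Fin d) (Fin d) ℂ) :=
  Submodule.span ℂ {matE d, matF d, matH d}

lemma matE_mem_sl2Image (d : ℕ) : matE d ∈ sl2Image d := Submodule.subset_span (by simp)

lemma matF_mem_sl2Image (d : ℕ) : matF d ∈ sl2Image d := Submodule.subset_span (by simp)

lemma matH_mem_sl2Image (d : ℕ) : matH d ∈ sl2Image d := Submodule.subset_span (by simp)

lemma sl2Image_le_sq (d : ℕ) : sl2Image d ≤ sl2Image d ^ 2 := by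
  have hE := matE_mem_sl2Image d
  have hF := matF_mem_sl2Image d
  have hH := matH_mem_sl2Image d
  have half {X : Matrix (Fin d) (Fin d) ℂ} (h : (2 : ℂ) • X ∈ sl2Image d * sl2Image d) :
      X ∈ sl2Image d * sl2Image d := (Submodule.smul_mem_iff _ two_ne_zero).1 h
  rw [pow_two]
  refine Submodule.span_le.2 ?_
  rintro X (rfl | rfl | rfl)
  · refine half ?_
    rw [← matH_commutator_matE]
    exact sub_mem (Submodule.mul_mem_mul hH hE) (Submodule.mul_mem_mul hE hH)
  · refine half ?_
    rw [← matF_commutator_matH]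
    exact sub_mem (Submodule.mul_mem_mul hF hH) (Submodule.mul_mem_mul hH hF)
  · rw [SetLike.mem_coe, ← matE_commutator_matF]
    exact sub_mem (Submodule.mul_mem_mul hE hF) (Submodule.mul_mem_mul hF hE)

lemma one_le_sl2Image_sq (d : ℕ) (hd : 2 ≤ d) : 1 ≤ sl2Image d ^ 2 := by
  have hE := matE_mem_sl2Image d
  have hF := matF_mem_sl2Image d
  have hH := matH_mem_sl2Image d
  have hne : (d : ℂ) ^ 2 - 1 ≠ 0 := by
    rw [sub_ne_zero]
    exact_mod_cast (by nlinarith : d ^ 2 ≠ 1)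
  rw [Submodule.one_le, ← Submodule.smul_mem_iff _ hne, ← casimir_eq_smul_one, pow_two]
  exact add_mem (Submodule.smul_mem _ _ (add_mem (Submodule.mul_mem_mul hE hF)
    (Submodule.mul_mem_mul hF hE))) (Submodule.mul_mem_mul hH hH)

lemma one_sup_sl2Image_pow_le (d : ℕ) (hd : 2 ≤ d) (n : ℕ) (hn : 2 ≤ n) :
    (1 ⊔ sl2Image d) ^ n ≤ sl2Image d ^ n := by
  have h1 := one_le_sl2Image_sq d hd
  have h2 := sl2Image_le_sq d
  induction n, hn using Nat.le_induction with
  | base =>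
    rw [pow_two (1 ⊔ sl2Image d), Submodule.sup_mul, one_mul, Submodule.mul_sup, mul_one,
      ← pow_two]
    exact sup_le (sup_le h1 h2) (sup_le h2 le_rfl)
  | succ n hn ih =>
    rw [pow_succ (1 ⊔ sl2Image d)]
    refine (mul_le_mul' ih le_rfl).trans ?_
    rw [Submodule.mul_sup, mul_one, ← pow_succ]
    refine sup_le ?_ le_rfl
    obtain ⟨m, rfl⟩ : ∃ m, n = m + 1 := ⟨n - 1, by omega⟩
    calc sl2Image d ^ (m + 1) = sl2Image d ^ m * sl2Image d := pow_succ _ _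
      _ ≤ sl2Image d ^ m * sl2Image d ^ 2 := mul_le_mul' le_rfl h2
      _ = sl2Image d ^ (m + 1 + 1) := by rw [← pow_add]

/-- The polynomial in `H` vanishing on the weights with index in `s`. -/
noncomputable def weightKiller (d : ℕ) (s : Finset ℕ) : Matrix (Fin d) (Fin d) ℂ :=
  diagonal fun a : Fin d => ∏ b ∈ s, (2 * (b : ℂ) - 2 * ((a : ℕ) : ℂ))

lemma weightKiller_mem (d : ℕ) (s : Finset ℕ) :
    weightKiller d s ∈ (1 ⊔ sl2Image d) ^ s.card := by
  induction s using Finset.induction_on with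
  | empty => simp [weightKiller, Submodule.one_le.1 le_rfl]
  | insert b s hb ih =>
    have hmul : weightKiller d (insert b s) =
        weightKiller d s * (matH d - ((d : ℂ) - 1 - 2 * b) • 1) := by
      rw [matH_eq_diagonal, ← Matrix.diagonal_one, ← Matrix.diagonal_smul, Matrix.diagonal_sub,
        weightKiller, weightKiller, Matrix.diagonal_mul_diagonal]
      congr 1
      ext a
      rw [Finset.prod_insert hb]
      simp only [Pi.smul_apply, smul_eq_mul]
      ring
    rw [hmul, Finset.card_insert_of_notMem hb, pow_succ]
    refine Submodule.mul_mem_mul ih (sub_mem ?_ (Submodule.smul_mem _ _ ?_))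
    · exact Submodule.mem_sup_right (matH_mem_sl2Image d)
    · exact Submodule.mem_sup_left (Submodule.one_le.1 le_rfl)

/-- Killing all but one of the weights in the image of a power of a superdiagonal matrix leaves a
nonzero multiple of a matrix unit. -/
lemma exists_superdiag_pow_mul_weightKiller (d : ℕ) (w : ℕ → ℂ) (hw : ∀ n, n + 1 < d → w n ≠ 0)
    (i j : Fin d) (hij : i ≤ j) :
    ∃ c : ℂ, c ≠ 0 ∧ superdiag d w ^ ((j : ℕ) - i) *
      weightKiller d ((Finset.Ico ((j : ℕ) - i) d).erase j) = c • Matrix.single i j 1 := by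
  have hij' : (i : ℕ) ≤ j := hij
  refine ⟨(∏ m ∈ Finset.range ((j : ℕ) - i), w (i + m)) *
    ∏ b ∈ (Finset.Ico ((j : ℕ) - i) d).erase j, (2 * (b : ℂ) - 2 * ((j : ℕ) : ℂ)), ?_, ?_⟩
  · refine mul_ne_zero (Finset.prod_ne_zero_iff.2 fun m hm => hw _ ?_)
      (Finset.prod_ne_zero_iff.2 fun b hb => ?_)
    · have := Finset.mem_range.1 hm
      omega
    · rw [← mul_sub]
      refine mul_ne_zero two_ne_zero (sub_ne_zero.2 ?_)
      exact_mod_cast (Finset.mem_erase.1 hb).1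
  · ext a b
    rw [weightKiller, Matrix.mul_diagonal, superdiag_pow_apply, Matrix.smul_apply,
      Matrix.single_apply, smul_eq_mul]
    by_cases hb : b = j
    · subst hb
      by_cases ha : i = a
      · subst ha
        rw [if_pos (by omega), if_pos ⟨rfl, rfl⟩, mul_one]
      · have : (i : ℕ) ≠ a := fun h => ha (Fin.ext h)
        rw [if_neg (by omega), if_neg (by tauto)]
        simp
    · rw [if_neg (by tauto : ¬(i = a ∧ j = b)), mul_zero]
      split_ifs with h
      · refine mul_eq_zero_of_right _ (Finset.prod_eq_zero (i := (b : ℕ)) ?_ (sub_self _))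
        have : (b : ℕ) ≠ j := fun h => hb (Fin.ext h)
        simp only [Finset.mem_erase, Finset.mem_Ico]
        omega
      · simp

lemma single_mem_one_sup_sl2Image_pow (d : ℕ) (i j : Fin d) :
    Matrix.single i j (1 : ℂ) ∈ (1 ⊔ sl2Image d) ^ (d - 1) := by
  have hcard (k l : Fin d) (hkl : k ≤ l) :
      ((l : ℕ) - k) + ((Finset.Ico ((l : ℕ) - k) d).erase l).card = d - 1 := by
    have hkl' : (k : ℕ) ≤ l := hkl
    rw [Finset.card_erase_of_mem (by simp only [Finset.mem_Ico]; omega), Nat.card_Ico]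
    omega
  rcases le_total i j with h | h
  · obtain ⟨c, hc, hX⟩ := exists_superdiag_pow_mul_weightKiller d (fun n => (n : ℂ) + 1)
      (fun n _ => Nat.cast_add_one_ne_zero n) i j h
    rw [← Submodule.smul_mem_iff _ hc, ← hX, ← matE_eq_superdiag, ← hcard i j h, pow_add]
    exact Submodule.mul_mem_mul
      (Submodule.pow_mem_pow _ (Submodule.mem_sup_right (matE_mem_sl2Image d)) _)
      (weightKiller_mem d _)
  · obtain ⟨c, hc, hX⟩ := exists_superdiag_pow_mul_weightKiller d
      (fun n => (d : ℂ) - ((n : ℂ) + 1))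
      (fun n hn => sub_ne_zero.2 (by exact_mod_cast hn.ne')) j i h
    have hX' := congrArg Matrix.transpose hX
    rw [Matrix.transpose_mul, Matrix.transpose_pow, ← matF_eq_transpose_superdiag,
      Matrix.transpose_smul, Matrix.transpose_single, weightKiller, Matrix.diagonal_transpose,
      ← weightKiller] at hX'
    rw [← Submodule.smul_mem_iff _ hc, ← hX', ← hcard j i h, add_comm, pow_add]
    exact Submodule.mul_mem_mul (weightKiller_mem d _)
      (Submodule.pow_mem_pow _ (Submodule.mem_sup_right (matF_mem_sl2Image d)) _)

lemma sl2Image_pow_eq_top (d : ℕ) (hd : 3 ≤ d) : sl2Image d ^ (d - 1) = ⊤ := by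
  refine eq_top_iff.2 fun X _ => ?_
  rw [Matrix.matrix_eq_sum_single X]
  refine sum_mem fun i _ => sum_mem fun j _ => ?_
  rw [← mul_one (X i j), ← smul_eq_mul, ← Matrix.smul_single]
  exact Submodule.smul_mem _ _ (one_sup_sl2Image_pow_le d (by omega) _ (by omega)
    (single_mem_one_sup_sl2Image_pow d i j))

/-- For `d ≥ 3`, with `g = span_ℂ{E, F, H} = ρ^{(d)}(sl₂(ℂ))`, the set of all
products `M₁·M₂⋯M_{d-1}` with each `M_k ∈ g` spans the full algebra of `d×d`
complex matrices as a `ℂ`-vector space. -/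
theorem stmt8 (d : ℕ) (hd : 3 ≤ d) :
    Submodule.span ℂ
      {M : Matrix (Fin d) (Fin d) ℂ |
        ∃ A : Fin (d - 1) → Matrix (Fin d) (Fin d) ℂ,
          (∀ k, A k ∈ Submodule.span ℂ
            ({matE d, matF d, matH d} : Set (Matrix (Fin d) (Fin d) ℂ))) ∧
          M = (List.ofFn A).prod} = ⊤ := by
  rw [eq_top_iff, ← sl2Image_pow_eq_top d hd, Submodule.pow_eq_span_pow_set]
  refine Submodule.span_mono fun X hX => ?_
  obtain ⟨A, rfl⟩ := Set.mem_pow.1 hX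
  exact ⟨fun k => A k, fun k => (A k).2, rfl⟩
end
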